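/- Under Assumptions 1 and 3 and with κ ∈ (0,1/2], let Γ be a constrained potential game with potential φ, let ρ be an M-straight-route of the PHPIP chain from z^1 = (a^1, a^1) to z^2 = (a^2, a^2) through diag(A)-nodes z^{(1)} = z^1, …, z^{(M)} = z^2, and let ρ' be the reverse M-straight-route from z^2 to z^1 through the same nodes in reverse order. Then the resistances satisfy the exact identity χ(ρ) = χ(ρ') + φ(a^1) − φ(a^2). -/

import Mathlib

open Filter Topology Set

attribute [local instance] Classical.propDecidable

section PHPIP

variable {ι : Type*} [Fintype ι] [DecidableEq ι] {A : ι → Type*} [∀ i, Fintype (A i)]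

/-- Assumption 1 on the constraint maps. -/
def Assumption1 (C : ∀ i, A i → Finset (A i)) : Prop :=
  (∀ (i : ι) (a b : A i), b ∈ C i a ↔ a ∈ C i b) ∧
  (∀ (i : ι) (a b : A i), ∃ (nf : ℕ) (f : ℕ → A i), f 0 = a ∧ f nf = b ∧
      ∀ k < nf, f (k + 1) ∈ C i (f k)) ∧
  (∀ (i : ι) (a : A i), 3 ≤ (C i a).card)

/-- Assumption 3: unilateral constrained deviations change the utility by less than 1/2. -/
def Assumption3 (U : ι → (∀ i, A i) → ℝ) (C : ∀ i, A i → Finset (A i)) : Prop :=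
  ∀ (i : ι) (a : ∀ j, A j) (b : A i), b ∈ C i (a i) →
    U i (Function.update a i b) - U i a < 1 / 2

/-- Γ is a constrained potential game with potential function φ. -/
def IsPotentialGame (U : ι → (∀ i, A i) → ℝ) (C : ∀ i, A i → Finset (A i))
    (φ : (∀ i, A i) → ℝ) : Prop :=
  ∀ (i : ι) (a : ∀ j, A j) (b : A i), b ∈ C i (a i) →
    U i (Function.update a i b) - U i a = φ (Function.update a i b) - φ a

/-- Probability that, from state `(a0, a1)`, player `i` selects the action `x`
under the PHPIP selection rule with exploration rate `ε` and parameter `κ`. -/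
noncomputable def selProb (κ : ℝ) (U : ι → (∀ i, A i) → ℝ)
    (C : ∀ i, A i → Finset (A i)) (ε : ℝ) (a0 a1 : ∀ i, A i) (i : ι) (x : A i) : ℝ :=
  if U i a0 ≤ U i a1 then
    (if x = a1 i then 1 - ε else 0) +
      (if x ∈ (C i (a1 i)).erase (a1 i) then
        ε / ((C i (a1 i)).erase (a1 i)).card else 0)
  else
    (if x = a1 i then (1 - ε) * (κ * ε ^ (U i a0 - U i a1)) else 0) +
      (if x = a0 i then (1 - ε) * (1 - κ * ε ^ (U i a0 - U i a1)) else 0) +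
      (if x ∈ ((C i (a1 i)).erase (a1 i)).erase (a0 i) then
        ε / (((C i (a1 i)).erase (a1 i)).erase (a0 i)).card else 0)

/-- One-step transition probability of the Markov chain `{P^ε}` induced by PHPIP
on pairs of joint actions. -/
noncomputable def phTrans (κ : ℝ) (U : ι → (∀ i, A i) → ℝ)
    (C : ∀ i, A i → Finset (A i)) (ε : ℝ)
    (z1 z2 : (∀ i, A i) × (∀ i, A i)) : ℝ :=
  if z2.1 = z1.2 then ∏ i, selProb κ U C ε z1.1 z1.2 i (z2.2 i) else 0

/-- The state space B. -/
def memB (C : ∀ i, A i → Finset (A i)) (z : (∀ i, A i) × (∀ i, A i)) : Prop :=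
  ∀ i, z.2 i ∈ C i (z.1 i)

/-- k-step transition probabilities of the homogeneous chain `{P^ε}`. -/
noncomputable def phTransPow (κ : ℝ) (U : ι → (∀ i, A i) → ℝ)
    (C : ∀ i, A i → Finset (A i)) (ε : ℝ) :
    ℕ → (∀ i, A i) × (∀ i, A i) → (∀ i, A i) × (∀ i, A i) → ℝ
  | 0, z, z' => if z = z' then 1 else 0
  | k + 1, z, z' => ∑ w : (∀ i, A i) × (∀ i, A i),
      phTrans κ U C ε z w * phTransPow κ U C ε k w z'

/-- Probability of a path (sequence of states) of the chain `{P^ε}`. -/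
noncomputable def pathProb (κ : ℝ) (U : ι → (∀ i, A i) → ℝ)
    (C : ∀ i, A i → Finset (A i)) (ε : ℝ) :
    List ((∀ i, A i) × (∀ i, A i)) → ℝ
  | [] => 1
  | [_] => 1
  | z :: z' :: rest => phTrans κ U C ε z z' * pathProb κ U C ε (z' :: rest)

/-- A transition is feasible if it has positive probability for some ε ∈ (0,1/2]. -/
def Feasible (κ : ℝ) (U : ι → (∀ i, A i) → ℝ) (C : ∀ i, A i → Finset (A i))
    (z z' : (∀ i, A i) × (∀ i, A i)) : Prop :=
  ∃ ε : ℝ, 0 < ε ∧ ε ≤ 1 / 2 ∧ 0 < phTrans κ U C ε z z'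

/-- `l` is a (feasible) path of the chain from `z1` to `z2`. -/
def IsPath (κ : ℝ) (U : ι → (∀ i, A i) → ℝ) (C : ∀ i, A i → Finset (A i))
    (z1 z2 : (∀ i, A i) × (∀ i, A i)) (l : List ((∀ i, A i) × (∀ i, A i))) : Prop :=
  l.head? = some z1 ∧ l.getLast? = some z2 ∧ l.Chain' (Feasible κ U C)

/-- `r` is the resistance of the path `l`:  `lim_{ε→0+} P^ε(l)/ε^r ∈ (0,∞)`. -/
def IsPathRes (κ : ℝ) (U : ι → (∀ i, A i) → ℝ) (C : ∀ i, A i → Finset (A i))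
    (l : List ((∀ i, A i) × (∀ i, A i))) (r : ℝ) : Prop :=
  ∃ L : ℝ, 0 < L ∧
    Tendsto (fun ε : ℝ => pathProb κ U C ε l / ε ^ r) (𝓝[>] (0 : ℝ)) (𝓝 L)

/-- `(a, b)` (as diagonal states `((a,a),(b,b))`) is a pair in `E_s`:
exactly one player deviates and the deviation is feasible. -/
def EsPair (C : ∀ i, A i → Finset (A i)) (a b : ∀ i, A i) : Prop :=
  (∃! i, a i ≠ b i) ∧ ∀ i, a i ≠ b i → b i ∈ C i (a i)

/-- The path (list of states) of the M-straight-route through the given diagonal nodes. -/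
def msrPath : List (∀ i, A i) → List ((∀ i, A i) × (∀ i, A i))
  | [] => []
  | [a] => [(a, a)]
  | a :: b :: rest => (a, a) :: (a, b) :: msrPath (b :: rest)

/-- Weight of the edge of the graph `G_R` from `z` to `z'`: the minimal resistance
among all paths of `{P^ε}` from `z` to `z'`. -/
noncomputable def edgeWeight (κ : ℝ) (U : ι → (∀ i, A i) → ℝ)
    (C : ∀ i, A i → Finset (A i)) (z z' : (∀ i, A i) × (∀ i, A i)) : ℝ :=
  sInf {r : ℝ | ∃ l, IsPath κ U C z z' l ∧ IsPathRes κ U C l r}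

/-- `y` is reachable from `x` in at most `d` constraint-feasible steps. -/
def ReachIn (C : ∀ i, A i → Finset (A i)) (i : ι) : ℕ → A i → A i → Prop
  | 0, x, y => x = y
  | d + 1, x, y => ReachIn C i d x y ∨ ∃ w, ReachIn C i d x w ∧ y ∈ C i w

/-- Inhomogeneous products: `transProd κ U C εs k0 m` is the transition matrix
`P(k0, k0 + m) = ∏_{k'=k0}^{k0+m-1} P_{k'}` of the PIPIP chain with exploration
rates `εs`. -/
noncomputable def transProd (κ : ℝ) (U : ι → (∀ i, A i) → ℝ)
    (C : ∀ i, A i → Finset (A i)) (εs : ℕ → ℝ) (k0 : ℕ) :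
    ℕ → (∀ i, A i) × (∀ i, A i) → (∀ i, A i) × (∀ i, A i) → ℝ
  | 0, z, z' => if z = z' then 1 else 0
  | m + 1, z, z' => ∑ w : (∀ i, A i) × (∀ i, A i),
      transProd κ U C εs k0 m z w * phTrans κ U C (εs (k0 + m)) w z'

/-- The PIPIP exploration rate `ε(k) = k^{-1/(n(D+1))}`. -/
noncomputable def pipipRate (n D : ℕ) (k : ℕ) : ℝ :=
  (k : ℝ) ^ (-(1 : ℝ) / ((n : ℝ) * ((D : ℝ) + 1)))

/-- Accessibility along the unperturbed chain `{P^0}`. -/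
def Accessible0 (κ : ℝ) (U : ι → (∀ i, A i) → ℝ) (C : ∀ i, A i → Finset (A i))
    (z z' : (∀ i, A i) × (∀ i, A i)) : Prop :=
  ∃ k : ℕ, 0 < phTransPow κ U C 0 k z z'

/-- A recurrent communication class of the unperturbed chain `{P^0}`. -/
def IsRecClass (κ : ℝ) (U : ι → (∀ i, A i) → ℝ) (C : ∀ i, A i → Finset (A i))
    (H : Set ((∀ i, A i) × (∀ i, A i))) : Prop :=
  H.Nonempty ∧ (∀ z ∈ H, ∀ z' ∈ H, Accessible0 κ U C z z') ∧
    (∀ z ∈ H, ∀ z', Accessible0 κ U C z z' → z' ∈ H)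

end PHPIP

section Resistance

/-- `f ε` decays like `ε ^ r` as `ε → 0+`. -/
def HasResistance (f : ℝ → ℝ) (r : ℝ) : Prop :=
  ∃ L : ℝ, 0 < L ∧ Tendsto (fun ε : ℝ => f ε / ε ^ r) (𝓝[>] (0 : ℝ)) (𝓝 L)

theorem HasResistance.congr {f g : ℝ → ℝ} {r : ℝ} (hf : HasResistance f r)
    (h : ∀ ε, f ε = g ε) : HasResistance g r :=
  funext h ▸ hf

theorem HasResistance.mul {f g : ℝ → ℝ} {r s : ℝ} (hf : HasResistance f r)
    (hg : HasResistance g s) : HasResistance (fun ε => f ε * g ε) (r + s) := by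
  obtain ⟨L, hL, hf⟩ := hf
  obtain ⟨M, hM, hg⟩ := hg
  refine ⟨L * M, mul_pos hL hM, (hf.mul hg).congr' ?_⟩
  filter_upwards [self_mem_nhdsWithin] with ε hε
  rw [Real.rpow_add hε, mul_div_mul_comm]

theorem hasResistance_of_tendsto {f : ℝ → ℝ} {L : ℝ} (hL : 0 < L)
    (hf : Tendsto f (𝓝[>] 0) (𝓝 L)) : HasResistance f 0 :=
  ⟨L, hL, by simpa using hf⟩

theorem hasResistance_const {c : ℝ} (hc : 0 < c) : HasResistance (fun _ => c) 0 :=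
  hasResistance_of_tendsto hc tendsto_const_nhds

theorem hasResistance_one_sub : HasResistance (fun ε => 1 - ε) 0 := by
  refine hasResistance_of_tendsto one_pos (Tendsto.mono_left ?_ nhdsWithin_le_nhds)
  have h : Continuous fun ε : ℝ => 1 - ε := by fun_prop
  simpa using h.tendsto 0

theorem hasResistance_rpow (r : ℝ) : HasResistance (fun ε => ε ^ r) r := by
  refine ⟨1, one_pos, tendsto_const_nhds.congr' ?_⟩
  filter_upwards [self_mem_nhdsWithin] with ε hε
  exact (div_self (Real.rpow_pos_of_pos hε r).ne').symm

theorem HasResistance.prod {ι : Type*} (t : Finset ι) {f : ι → ℝ → ℝ} {r : ι → ℝ}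
    (h : ∀ i ∈ t, HasResistance (f i) (r i)) :
    HasResistance (fun ε => ∏ i ∈ t, f i ε) (∑ i ∈ t, r i) := by
  induction t using Finset.cons_induction with
  | empty => simpa using hasResistance_const one_pos
  | cons i t hi ih =>
    simp only [Finset.prod_cons, Finset.sum_cons]
    exact (h i (Finset.mem_cons_self i t)).mul
      (ih fun j hj => h j (Finset.mem_cons_of_mem hj))

theorem HasResistance.le {f : ℝ → ℝ} {r s : ℝ} (hr : HasResistance f r)
    (hs : HasResistance f s) : s ≤ r := by
  obtain ⟨L, hL, hr⟩ := hr
  obtain ⟨M, -, hs⟩ := hs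
  by_contra! hlt
  have hpow : Tendsto (fun ε : ℝ => ε ^ (s - r)) (𝓝[>] 0) (𝓝 0) := by
    have h := (Real.continuousAt_rpow_const 0 (s - r) (Or.inr (sub_nonneg.2 hlt.le))).tendsto
    rw [Real.zero_rpow (sub_pos.2 hlt).ne'] at h
    exact h.mono_left nhdsWithin_le_nhds
  have hzero : Tendsto (fun ε : ℝ => f ε / ε ^ r) (𝓝[>] 0) (𝓝 (M * 0)) := by
    refine (hs.mul hpow).congr' ?_
    filter_upwards [self_mem_nhdsWithin] with ε hε
    have h1 := (Real.rpow_pos_of_pos hε r).ne'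
    have h2 := (Real.rpow_pos_of_pos hε s).ne'
    rw [Real.rpow_sub hε]
    field_simp
  rw [mul_zero] at hzero
  exact hL.ne' (tendsto_nhds_unique hr hzero)

theorem HasResistance.unique {f : ℝ → ℝ} {r s : ℝ} (hr : HasResistance f r)
    (hs : HasResistance f s) : r = s :=
  le_antisymm (hs.le hr) (hr.le hs)

end Resistance

section Routes

/-- Resistance of the straight route through the given diagonal nodes in a potential game. -/
noncomputable def routeResistance {α : Type*} (φ : α → ℝ) : List α → ℝ
  | [] => 0
  | [_] => 0
  | a :: b :: rest => (1 + max (φ a - φ b) 0) + routeResistance φ (b :: rest)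

theorem routeResistance_append_pair {α : Type*} (φ : α → ℝ) (l : List α) (b a : α) :
    routeResistance φ (l ++ [b, a]) =
      routeResistance φ (l ++ [b]) + (1 + max (φ b - φ a) 0) := by
  induction l with
  | nil => simp [routeResistance]
  | cons x l ih =>
    cases l with
    | nil => simp [routeResistance]
    | cons y l =>
      simp only [List.cons_append, routeResistance] at ih ⊢
      rw [ih]
      ring

theorem routeResistance_reverse {α : Type*} (φ : α → ℝ) :
    ∀ (l : List α) (a b : α), l.head? = some a → l.getLast? = some b →
      routeResistance φ l = routeResistance φ l.reverse + φ a - φ b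
  | [], a, b, ha, _ => by simp at ha
  | [x], a, b, ha, hb => by
    obtain rfl : x = a := by simpa using ha
    obtain rfl : x = b := by simpa using hb
    simp [routeResistance]
  | x :: y :: l, a, b, ha, hb => by
    obtain rfl : x = a := by simpa using ha
    have ih := routeResistance_reverse φ (y :: l) y b rfl (by simpa using hb)
    have h := routeResistance_append_pair φ l.reverse y x
    simp only [List.reverse_cons, List.append_assoc, List.cons_append, List.nil_append,
      routeResistance] at ih h ⊢
    rw [ih, h]
    have hmax : max (φ x - φ y) 0 = max (φ y - φ x) 0 + φ x - φ y := by
      rcases le_total (φ x) (φ y) with hxy | hxy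
      · rw [max_eq_right (by linarith), max_eq_left (by linarith)]; ring
      · rw [max_eq_left (by linarith), max_eq_right (by linarith)]; ring
    rw [hmax]
    ring

end Routes

section SelectionRule

variable {ι : Type*} {A : ι → Type*}

theorem EsPair.symm {C : ∀ i, A i → Finset (A i)} (hA1 : Assumption1 C) {a b : ∀ i, A i}
    (h : EsPair C a b) : EsPair C b a := by
  refine ⟨?_, fun i hi => (hA1.1 i _ _).1 (h.2 i hi.symm)⟩
  simpa only [ne_comm] using h.1

theorem selProb_stay (κ : ℝ) (U : ι → (∀ i, A i) → ℝ) (C : ∀ i, A i → Finset (A i))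
    (ε : ℝ) {a b : ∀ i, A i} {i : ι} (h : a i = b i) :
    selProb κ U C ε a b i (b i) = 1 - ε := by
  simp only [selProb, h, if_true, Finset.mem_erase, ne_eq, not_true_eq_false, false_and,
    if_false]
  split_ifs <;> ring

theorem selProb_explore (κ : ℝ) (U : ι → (∀ i, A i) → ℝ) (C : ∀ i, A i → Finset (A i))
    (ε : ℝ) {a : ∀ i, A i} {i : ι} {x : A i} (hx : x ≠ a i) (hC : x ∈ C i (a i)) :
    selProb κ U C ε a a i x = ε / ((C i (a i)).erase (a i)).card := by
  simp [selProb, hx, hC]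

theorem selProb_keep (κ : ℝ) (U : ι → (∀ i, A i) → ℝ) (C : ∀ i, A i → Finset (A i))
    (ε : ℝ) {a b : ∀ i, A i} {i : ι} (h : a i ≠ b i) :
    selProb κ U C ε a b i (b i) =
      if U i a ≤ U i b then 1 - ε else (1 - ε) * (κ * ε ^ (U i a - U i b)) := by
  simp [selProb, h.symm]

theorem msrPath_cons (b : ∀ i, A i) (l : List (∀ i, A i)) :
    ∃ t, msrPath (b :: l) = (b, b) :: t := by
  cases l <;> exact ⟨_, rfl⟩

end SelectionRule

section StraightRoutes

variable {ι : Type*} [Fintype ι] [DecidableEq ι] {A : ι → Type*}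

theorem hasResistance_phTrans_of_deviation {κ : ℝ} {U : ι → (∀ i, A i) → ℝ}
    {C : ∀ i, A i → Finset (A i)} {a b c : ∀ i, A i} {i : ι} {w : ℝ}
    (hdev : HasResistance (fun ε => selProb κ U C ε a b i (c i)) w)
    (hstay : ∀ j ≠ i, a j = b j ∧ c j = b j) :
    HasResistance (fun ε => phTrans κ U C ε (a, b) (b, c)) w := by
  have h := HasResistance.prod Finset.univ
    (f := fun j ε => selProb κ U C ε a b j (c j)) (r := Pi.single i w) (fun j _ => by
      rcases eq_or_ne j i with rfl | hj
      · simpa using hdev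
      · rw [Pi.single_eq_of_ne hj, (hstay j hj).2]
        exact hasResistance_one_sub.congr fun ε => (selProb_stay κ U C ε (hstay j hj).1).symm)
  rw [Finset.sum_pi_single' i w Finset.univ, if_pos (Finset.mem_univ i)] at h
  simpa [phTrans] using h

theorem hasResistance_phTrans_explore {κ : ℝ} {U : ι → (∀ i, A i) → ℝ}
    {C : ∀ i, A i → Finset (A i)} {a b : ∀ i, A i} (h : EsPair C a b) :
    HasResistance (fun ε => phTrans κ U C ε (a, a) (a, b)) 1 := by
  obtain ⟨⟨i, hi, huniq⟩, hC⟩ := h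
  refine hasResistance_phTrans_of_deviation (i := i) ?_ fun j hj =>
    ⟨rfl, by_contra fun hne => hj (huniq j (Ne.symm hne))⟩
  have hcard : 0 < (((C i (a i)).erase (a i)).card : ℝ) :=
    Nat.cast_pos.2 (Finset.card_pos.2 ⟨b i, Finset.mem_erase.2 ⟨hi.symm, hC i hi⟩⟩)
  have hres := (hasResistance_rpow 1).mul (hasResistance_const (inv_pos.2 hcard))
  rw [add_zero] at hres
  refine hres.congr fun ε => ?_
  rw [selProb_explore κ U C ε hi.symm (hC i hi), Real.rpow_one, div_eq_mul_inv]

theorem hasResistance_phTrans_keep {κ : ℝ} (hκ : 0 < κ) {U : ι → (∀ i, A i) → ℝ}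
    {C : ∀ i, A i → Finset (A i)} {φ : (∀ i, A i) → ℝ} (hpot : IsPotentialGame U C φ)
    {a b : ∀ i, A i} (h : EsPair C a b) :
    HasResistance (fun ε => phTrans κ U C ε (a, b) (b, b)) (max (φ a - φ b) 0) := by
  obtain ⟨⟨i, hi, huniq⟩, hC⟩ := h
  have heq : ∀ j ≠ i, a j = b j := fun j hj => by_contra fun hne => hj (huniq j hne)
  have hupd : Function.update a i (b i) = b := by
    funext j
    rcases eq_or_ne j i with rfl | hj
    · simp
    · rw [Function.update_of_ne hj, heq j hj]
  have hφ := hpot i a (b i) (hC i hi)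
  rw [hupd] at hφ
  refine hasResistance_phTrans_of_deviation (i := i) ?_ fun j hj => ⟨heq j hj, rfl⟩
  simp only [selProb_keep κ U C _ hi]
  by_cases hU : U i a ≤ U i b
  · simp only [if_pos hU]
    rw [max_eq_right (by linarith)]
    exact hasResistance_one_sub
  · simp only [if_neg hU]
    rw [max_eq_left (by linarith), show φ a - φ b = 0 + (0 + (U i a - U i b)) by linarith]
    exact hasResistance_one_sub.mul ((hasResistance_const hκ).mul (hasResistance_rpow _))

theorem isPathRes_msrPath {κ : ℝ} (hκ : 0 < κ) {U : ι → (∀ i, A i) → ℝ}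
    {C : ∀ i, A i → Finset (A i)} {φ : (∀ i, A i) → ℝ} (hpot : IsPotentialGame U C φ) :
    ∀ l : List (∀ i, A i), l.IsChain (EsPair C) →
      IsPathRes κ U C (msrPath l) (routeResistance φ l)
  | [], _ => hasResistance_const one_pos
  | [_], _ => hasResistance_const one_pos
  | a :: b :: l, h => by
    obtain ⟨hab, hl⟩ := List.isChain_cons_cons.1 h
    have ih : HasResistance _ _ := isPathRes_msrPath hκ hpot (b :: l) hl
    obtain ⟨t, ht⟩ := msrPath_cons b l
    have hres := (hasResistance_phTrans_explore (κ := κ) (U := U) hab).mul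
      ((hasResistance_phTrans_keep hκ hpot hab).mul ih)
    rw [← add_assoc] at hres
    refine hres.congr fun ε => ?_
    simp only [msrPath, ht, pathProb]

end StraightRoutes

section Theorems

variable {ι : Type*} [Fintype ι] [DecidableEq ι] {A : ι → Type*} [∀ i, Fintype (A i)]

theorem statement11
    (U : ι → (∀ i, A i) → ℝ) (C : ∀ i, A i → Finset (A i)) (φ : (∀ i, A i) → ℝ)
    (κ : ℝ) (hκ0 : 0 < κ) (hκ : κ ≤ 1 / 2)
    (hA1 : Assumption1 C) (hA3 : Assumption3 U C) (hpot : IsPotentialGame U C φ)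
    (nodes : List (∀ i, A i)) (a1 a2 : ∀ i, A i)
    (hhead : nodes.head? = some a1) (hlast : nodes.getLast? = some a2)
    (hnodup : nodes.Nodup) (hchain : nodes.Chain' (EsPair C))
    (r r' : ℝ) (hr : IsPathRes κ U C (msrPath nodes) r)
    (hr' : IsPathRes κ U C (msrPath nodes.reverse) r') :
    r = r' + φ a1 - φ a2 := by
  have hrev : nodes.reverse.IsChain (EsPair C) :=
    List.isChain_reverse.2 (List.IsChain.imp (fun _ _ h => h.symm hA1) hchain)
  rw [HasResistance.unique hr (isPathRes_msrPath hκ0 hpot nodes hchain),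
    HasResistance.unique hr' (isPathRes_msrPath hκ0 hpot nodes.reverse hrev)]
  exact routeResistance_reverse φ nodes a1 a2 hhead hlast

end Theorems
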